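/- Let d, ℓ ∈ ℕ, α ∈ (0,1], and let u : closure(ℝ^d₊) → ℝ^ℓ be α-Hölder continuous with u = 0 on the boundary hyperplane {x_d = 0}. Then for every ε > 0 and every x ∈ ℝ^d, the total derivative of S_ε(u) satisfies |∇S_ε(u)(x)| ≤ c_ρ · [u]_{C^{0,α}} · ε^{α−1}, where c_ρ := ∫_{ℝ^d} |∇ρ(y)| dy. -/

import Mathlib

open MeasureTheory
open scoped ENNReal NNReal

/-- The index of the last coordinate `x_d` in `ℝ^d`. -/
def halfIdx (d : ℕ) (hd : 0 < d) : Fin d := ⟨d - 1, Nat.sub_lt hd Nat.one_pos⟩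

/-- Extension by zero outside of the open half-space `{x : x_d > 0}`. -/
noncomputable def zeroExt {d : ℕ} (hd : 0 < d) {F : Type*} [Zero F]
    (u : EuclideanSpace ℝ (Fin d) → F) (x : EuclideanSpace ℝ (Fin d)) : F :=
  if 0 < x (halfIdx d hd) then u x else 0

/-- The rescaled mollifier `ρ_ε(x) = ε^{-d} ρ(x/ε)`. -/
noncomputable def molli {d : ℕ} (ρ : EuclideanSpace ℝ (Fin d) → ℝ) (ε : ℝ)
    (x : EuclideanSpace ℝ (Fin d)) : ℝ := (ε ^ d)⁻¹ * ρ (ε⁻¹ • x)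

/-- The convolution–translation operator
`S_ε(u)(x) = ∫ ρ_ε(y) ū(x − 2ε e_d − y) dy`. -/
noncomputable def convTrans {d ℓ : ℕ} (hd : 0 < d) (ρ : EuclideanSpace ℝ (Fin d) → ℝ)
    (ε : ℝ) (u : EuclideanSpace ℝ (Fin d) → EuclideanSpace ℝ (Fin ℓ))
    (x : EuclideanSpace ℝ (Fin d)) : EuclideanSpace ℝ (Fin ℓ) :=
  ∫ y, molli ρ ε y •
    zeroExt hd u (x - (2 * ε) • EuclideanSpace.single (halfIdx d hd) (1 : ℝ) - y)

/-- The extension by zero of a Hölder function on the closed half-space that vanishes on the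
boundary hyperplane satisfies the same Hölder estimate on the whole space. -/
lemma norm_zeroExt_sub_le {d : ℕ} (hd : 0 < d) {F : Type*} [NormedAddCommGroup F] {α : ℝ}
    (hα : 0 ≤ α) {u : EuclideanSpace ℝ (Fin d) → F} {C : ℝ} (hC₀ : 0 ≤ C)
    (hC : ∀ x y : EuclideanSpace ℝ (Fin d), 0 ≤ x (halfIdx d hd) →
      0 ≤ y (halfIdx d hd) → ‖u x - u y‖ ≤ C * ‖x - y‖ ^ α)
    (hu : ∀ x : EuclideanSpace ℝ (Fin d), x (halfIdx d hd) = 0 → u x = 0)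
    (x y : EuclideanSpace ℝ (Fin d)) :
    ‖zeroExt hd u x - zeroExt hd u y‖ ≤ C * ‖x - y‖ ^ α := by
  have crossing : ∀ x y : EuclideanSpace ℝ (Fin d), 0 < x (halfIdx d hd) →
      ¬ 0 < y (halfIdx d hd) → ‖u x‖ ≤ C * ‖x - y‖ ^ α := by
    intro x y hx hy
    rw [not_lt] at hy
    set t : ℝ := x (halfIdx d hd) / (x (halfIdx d hd) - y (halfIdx d hd)) with ht
    have hpos : 0 < x (halfIdx d hd) - y (halfIdx d hd) := by linarith
    have ht0 : 0 ≤ t := by positivity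
    have ht1 : t ≤ 1 := by rw [ht, div_le_one hpos]; linarith
    have hz : (x - t • (x - y)) (halfIdx d hd) = 0 := by
      simp only [PiLp.sub_apply, PiLp.smul_apply, smul_eq_mul, ht]
      field_simp
      ring
    have h := hC x (x - t • (x - y)) hx.le hz.ge
    rw [hu _ hz, sub_zero, sub_sub_cancel, norm_smul, Real.norm_of_nonneg ht0] at h
    refine h.trans ?_
    gcongr
    exact mul_le_of_le_one_left (norm_nonneg _) ht1
  unfold zeroExt
  split_ifs with hx hy hy
  · exact hC x y hx.le hy.le
  · simpa using crossing x y hx hy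
  · simpa [norm_sub_rev] using crossing y x hy hx
  · simpa using by positivity

/-- A map satisfying a Hölder estimate of positive exponent is continuous. -/
lemma continuous_of_norm_sub_le_rpow {E F : Type*} [NormedAddCommGroup E] [NormedAddCommGroup F]
    {v : E → F} {C α : ℝ} (hα : 0 < α) (hv : ∀ x y, ‖v x - v y‖ ≤ C * ‖x - y‖ ^ α) :
    Continuous v := by
  refine continuous_iff_continuousAt.2 fun x => ?_
  refine tendsto_iff_norm_sub_tendsto_zero.2 ?_
  refine squeeze_zero (fun _ => norm_nonneg _) (fun y => hv y x) ?_
  have h : Continuous fun y => C * ‖y - x‖ ^ α :=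
    continuous_const.mul ((continuous_id.sub continuous_const).norm.rpow_const
      fun _ => Or.inr hα.le)
  simpa [Real.zero_rpow hα.ne'] using h.tendsto x

lemma fderiv_molli {d : ℕ} (ρ : EuclideanSpace ℝ (Fin d) → ℝ) (ε : ℝ)
    (y : EuclideanSpace ℝ (Fin d)) :
    fderiv ℝ (molli ρ ε) y = ((ε ^ d)⁻¹ * ε⁻¹) • fderiv ℝ ρ (ε⁻¹ • y) := by
  have h : molli ρ ε = (ε ^ d)⁻¹ • fun y => ρ (ε⁻¹ • y) := rfl
  rw [h, fderiv_const_smul_field, Pi.smul_apply, fderiv_comp_smul, smul_smul]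

/-- The total variation of the rescaled mollifier. -/
lemma integral_norm_fderiv_molli {d : ℕ} (ρ : EuclideanSpace ℝ (Fin d) → ℝ) {ε : ℝ}
    (hε : 0 < ε) :
    ∫ y, ‖fderiv ℝ (molli ρ ε) y‖ = ε⁻¹ * ∫ y, ‖fderiv ℝ ρ y‖ := by
  simp_rw [fderiv_molli, norm_smul]
  rw [integral_const_mul,
    Measure.integral_comp_inv_smul volume (fun y => ‖fderiv ℝ ρ y‖) ε]
  rw [finrank_euclideanSpace_fin, Real.norm_of_nonneg (by positivity),
    abs_of_pos (by positivity), smul_eq_mul]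
  field_simp

/-- The derivative of the convolution of a `C¹` kernel supported in a ball of radius `r` with a
function whose oscillation around `x` is at most `M` at distance at most `r`. -/
lemma norm_fderiv_integral_smul_le {G F : Type*} [NormedAddCommGroup G] [InnerProductSpace ℝ G]
    [FiniteDimensional ℝ G] [MeasurableSpace G] [BorelSpace G]
    [NormedAddCommGroup F] [NormedSpace ℝ F] [CompleteSpace F]
    {k : G → ℝ} {r M : ℝ} (hk : ContDiff ℝ 1 k) (hsupp : Function.support k ⊆ Metric.closedBall 0 r)
    {v : G → F} (hv : Continuous v) (x : G) (hM : ∀ y, ‖y‖ ≤ r → ‖v (x - y) - v x‖ ≤ M) :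
    ‖fderiv ℝ (fun z => ∫ y, k y • v (z - y)) x‖ ≤ (∫ y, ‖fderiv ℝ k y‖) * M := by
  have htsupp : tsupport k ⊆ Metric.closedBall 0 r :=
    closure_minimal hsupp Metric.isClosed_closedBall
  have hcs : HasCompactSupport k := HasCompactSupport.of_support_subset_isCompact
    (isCompact_closedBall 0 r) hsupp
  set w : G → F := fun z => v z - v x with hw
  have hwc : Continuous w := hv.sub continuous_const
  have hsplit : (fun z => ∫ y, k y • v (z - y)) =
      fun z => (∫ y, k y • w (z - y)) + ∫ y, k y • v x := by
    funext z
    rw [← integral_add]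
    · simp only [hw, ← smul_add, sub_add_cancel]
    · exact ((hk.continuous.smul (hwc.comp (continuous_const.sub continuous_id)))
        ).integrable_of_hasCompactSupport hcs.smul_right
    · exact (hk.continuous.smul continuous_const).integrable_of_hasCompactSupport hcs.smul_right
  have hderiv := hcs.hasFDerivAt_convolution_left (ContinuousLinearMap.lsmul ℝ ℝ) hk
    (μ := volume) hwc.locallyIntegrable x
  have hderiv' : HasFDerivAt (fun z => ∫ y, k y • v (z - y)) _ x :=
    hsplit ▸ hderiv.add_const (∫ y, k y • v x)
  rw [hderiv'.fderiv, ← integral_mul_const]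
  refine norm_integral_le_of_norm_le
    (((hk.continuous_fderiv one_ne_zero).integrable_of_hasCompactSupport
      (hcs.fderiv ℝ)).norm.mul_const M) (.of_forall fun y => ?_)
  by_cases hy : fderiv ℝ k y = 0
  · simp [hy]
  have hyr : ‖y‖ ≤ r := by
    simpa using htsupp (support_fderiv_subset ℝ hy)
  have hM0 : 0 ≤ M := (norm_nonneg _).trans (hM y hyr)
  refine ContinuousLinearMap.opNorm_le_bound _ (by positivity) fun e => ?_
  change ‖fderiv ℝ k y e • (v (x - y) - v x)‖ ≤ _
  rw [norm_smul, mul_right_comm]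
  exact mul_le_mul ((fderiv ℝ k y).le_opNorm e) (hM y hyr) (norm_nonneg _) (by positivity)

/-- If `u : closure(ℝ^d₊) → ℝ^ℓ` is `α`-Hölder continuous with
Hölder seminorm at most `C` and vanishes on the boundary hyperplane, then for
every `ε > 0` and every `x ∈ ℝ^d`,
`|∇S_ε(u)(x)| ≤ c_ρ · C · ε^{α−1}` with `c_ρ = ∫ |∇ρ|`. -/
theorem stmt_4 (d ℓ : ℕ) (hd : 0 < d) (α : ℝ) (hα0 : 0 < α) (hα1 : α ≤ 1)
    (ρ : EuclideanSpace ℝ (Fin d) → ℝ)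
    (hρ_smooth : ContDiff ℝ (⊤ : ℕ∞) ρ)
    (hρ_nonneg : ∀ x, 0 ≤ ρ x)
    (hρ_supp : ∀ x : EuclideanSpace ℝ (Fin d), ρ x ≠ 0 → ‖x‖ ≤ 1)
    (hρ_radial : ∀ x y : EuclideanSpace ℝ (Fin d), ‖x‖ = ‖y‖ → ρ x = ρ y)
    (hρ_int : ∫ x, ρ x = 1)
    (u : EuclideanSpace ℝ (Fin d) → EuclideanSpace ℝ (Fin ℓ)) (C : ℝ)
    (hC : ∀ x y : EuclideanSpace ℝ (Fin d), 0 ≤ x (halfIdx d hd) →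
      0 ≤ y (halfIdx d hd) → ‖u x - u y‖ ≤ C * ‖x - y‖ ^ α)
    (hu_bdry : ∀ x : EuclideanSpace ℝ (Fin d), x (halfIdx d hd) = 0 → u x = 0)
    (ε : ℝ) (hε : 0 < ε) (x : EuclideanSpace ℝ (Fin d)) :
    ‖fderiv ℝ (convTrans hd ρ ε u) x‖ ≤
      (∫ y, ‖fderiv ℝ ρ y‖) * C * ε ^ (α - 1) := by
  have hC₀ : 0 ≤ C := by
    have h := hC (EuclideanSpace.single (halfIdx d hd) 1) 0 (by simp) (by simp)
    simpa using (norm_nonneg _).trans h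
  have hv := norm_zeroExt_sub_le hd hα0.le hC₀ hC hu_bdry
  have hvc : Continuous (zeroExt hd u) := continuous_of_norm_sub_le_rpow hα0 hv
  have hk : ContDiff ℝ 1 (molli ρ ε) :=
    contDiff_const.mul ((hρ_smooth.of_le (by exact_mod_cast le_top)).comp (contDiff_const_smul _))
  have hsupp : Function.support (molli ρ ε) ⊆ Metric.closedBall 0 ε := by
    intro y hy
    have h := hρ_supp _ (right_ne_zero_of_mul hy)
    rw [norm_smul, norm_inv, Real.norm_of_nonneg hε.le, inv_mul_le_one₀ hε] at h
    simpa using h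
  set a : EuclideanSpace ℝ (Fin d) := (2 * ε) • EuclideanSpace.single (halfIdx d hd) (1 : ℝ)
  have hshift : fderiv ℝ (convTrans hd ρ ε u) x =
      fderiv ℝ (fun z => ∫ y, molli ρ ε y • zeroExt hd u (z - y)) (x - a) :=
    fderiv_comp_sub (f := fun z => ∫ y, molli ρ ε y • zeroExt hd u (z - y)) a
  rw [hshift]
  refine (norm_fderiv_integral_smul_le hk hsupp hvc (x - a) (M := C * ε ^ α)
    fun y hy => (hv _ _).trans ?_).trans_eq ?_
  · rw [sub_sub_cancel_left, norm_neg]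
    gcongr
  · rw [integral_norm_fderiv_molli ρ hε, Real.rpow_sub_one hε.ne']
    ring
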